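/- Let α₁ ≤ α₂ and β₂ ≤ β₁ be real numbers and let ε, δ ≥ 0 satisfy α₂ − ε ≥ α₁, β₁ − δ ≥ β₂, and e^{α₁+ε−1} + e^{β₁−δ−1} = e^{α₁−1} + e^{β₁−1}. Then e^{α₂−ε−1} + e^{β₂+δ−1} ≤ e^{α₂−1} + e^{β₂−1}. Equivalently, (1−e^{α₂−ε−1}) + (1−e^{β₂+δ−1}) ≥ (1−e^{α₂−1}) + (1−e^{β₂−1}). -/

import Mathlib

/-- The increments of `Real.exp` over intervals of a fixed length are monotone in the left
endpoint. -/
theorem exp_add_sub_exp_le {x y t : ℝ} (hxy : x ≤ y) (ht : 0 ≤ t) :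
    Real.exp (x + t) - Real.exp x ≤ Real.exp (y + t) - Real.exp y := by
  rw [Real.exp_add, Real.exp_add, ← mul_sub_one, ← mul_sub_one]
  exact mul_le_mul_of_nonneg_right (Real.exp_le_exp.mpr hxy)
    (sub_nonneg.mpr (Real.one_le_exp ht))

/-- **Core exchange inequality.**
Let `α₁ ≤ α₂`, `β₂ ≤ β₁`, and `ε, δ ≥ 0` with `α₂ − ε ≥ α₁`, `β₁ − δ ≥ β₂`, and
`e^{α₁+ε−1} + e^{β₁−δ−1} = e^{α₁−1} + e^{β₁−1}`. Then
`e^{α₂−ε−1} + e^{β₂+δ−1} ≤ e^{α₂−1} + e^{β₂−1}`; equivalently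
`(1−e^{α₂−ε−1}) + (1−e^{β₂+δ−1}) ≥ (1−e^{α₂−1}) + (1−e^{β₂−1})`. -/
theorem exp_exchange_inequality
    (α₁ α₂ β₁ β₂ ε δ : ℝ)
    (hα : α₁ ≤ α₂) (hβ : β₂ ≤ β₁)
    (hε : 0 ≤ ε) (hδ : 0 ≤ δ)
    (hαε : α₁ ≤ α₂ - ε) (hβδ : β₂ ≤ β₁ - δ)
    (hbal : Real.exp (α₁ + ε - 1) + Real.exp (β₁ - δ - 1)
          = Real.exp (α₁ - 1) + Real.exp (β₁ - 1)) :
    Real.exp (α₂ - ε - 1) + Real.exp (β₂ + δ - 1)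
      ≤ Real.exp (α₂ - 1) + Real.exp (β₂ - 1)
    ∧ (1 - Real.exp (α₂ - 1)) + (1 - Real.exp (β₂ - 1))
      ≤ (1 - Real.exp (α₂ - ε - 1)) + (1 - Real.exp (β₂ + δ - 1)) := by
  have hα_incr := exp_add_sub_exp_le (sub_le_sub_right hαε 1) hε
  have hβ_incr := exp_add_sub_exp_le (sub_le_sub_right hβδ 1) hδ
  rw [show α₁ - 1 + ε = α₁ + ε - 1 by ring, show α₂ - ε - 1 + ε = α₂ - 1 by ring] at hα_incr
  rw [show β₂ - 1 + δ = β₂ + δ - 1 by ring, show β₁ - δ - 1 + δ = β₁ - 1 by ring] at hβ_incr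
  constructor <;> linarith
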